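/- Assume n ≥ 2. The space of linear functionals φ : W_k → 𝕜 invariant under the alternating group of Fin n (φ(σ • g) = φ(g) for every even permutation σ) has a basis consisting of: the functionals f_P for set partitions P of Fin k with at most n − 2 blocks, together with the orbit-sum functionals g ↦ Σ_{i ∈ O} g(i), where O ranges over the alternating-group orbits of tuples i : Fin k → Fin n whose range has at least n − 1 elements. (This is the proposition that the f_D together with the f_D^± form a basis of Hom_{A_n}(V^{⊗k}, 1).) -/

import Mathlib

open scoped Classical

noncomputable section

namespace Jellyfish

variable {𝕜 : Type*} [Field 𝕜]

/-- The indicator (delta) function `δ_i` of a tuple `i`, a basis vector of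
`W = (ι → Fin n) → 𝕜`. -/
def delta {ι : Type*} {n : ℕ} (i : ι → Fin n) : (ι → Fin n) → 𝕜 :=
  fun j => if j = i then 1 else 0

/-- The linear action of `Equiv.Perm (Fin n)` on `(ι → Fin n) → 𝕜`; it satisfies
`permAct σ (delta i) = delta (σ ∘ i)`. -/
def permAct {ι : Type*} {n : ℕ} (σ : Equiv.Perm (Fin n)) (g : (ι → Fin n) → 𝕜) :
    (ι → Fin n) → 𝕜 :=
  fun j => g (⇑σ.symm ∘ j)

/-- `DET i`: the determinant of the `n × n` matrix whose `b`-th column is the standard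
basis vector `e_{i b}`; entry `(a,b)` is `1` if `i b = a` and `0` otherwise. -/
def DET {n : ℕ} (i : Fin n → Fin n) : 𝕜 :=
  Matrix.det (Matrix.of fun a b => if i b = a then (1 : 𝕜) else 0)

/-- `a` and `b` lie in a common block of the set partition `P`. -/
def sameBlock {ι : Type*} [DecidableEq ι] [Fintype ι]
    (P : Finpartition (Finset.univ : Finset ι)) (a b : ι) : Prop :=
  ∃ B ∈ P.parts, a ∈ B ∧ b ∈ B

/-- The tuple `i` is constant on every block of the set partition `P`. -/
def constOnBlocks {ι : Type*} [DecidableEq ι] [Fintype ι] {n : ℕ}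
    (P : Finpartition (Finset.univ : Finset ι)) (i : ι → Fin n) : Prop :=
  ∀ a b : ι, sameBlock P a b → i a = i b

/-- The kernel (partition into fibers) of the map `p` equals the set partition `P`. -/
def kernelEq {ι : Type*} [DecidableEq ι] [Fintype ι] {m : ℕ}
    (p : ι → Fin m) (P : Finpartition (Finset.univ : Finset ι)) : Prop :=
  ∀ a b : ι, p a = p b ↔ sameBlock P a b

/-- The linear functional `Φ_P` with `Φ_P (δ_i) = 1` if `i` is constant on every
block of `P`, and `0` otherwise. -/
def PhiP {k n : ℕ} (P : Finpartition (Finset.univ : Finset (Fin k))) :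
    ((Fin k → Fin n) → 𝕜) →ₗ[𝕜] 𝕜 :=
  ∑ i : Fin k → Fin n,
    (if constOnBlocks P i then (1 : 𝕜) else 0) •
      (LinearMap.proj i : ((Fin k → Fin n) → 𝕜) →ₗ[𝕜] 𝕜)

/-- The linear functional `f_P` with `f_P (δ_i) = 1` if the kernel of `i` equals `P`,
and `0` otherwise. -/
def fP {k n : ℕ} (P : Finpartition (Finset.univ : Finset (Fin k))) :
    ((Fin k → Fin n) → 𝕜) →ₗ[𝕜] 𝕜 :=
  ∑ i : Fin k → Fin n,
    (if kernelEq i P then (1 : 𝕜) else 0) •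
      (LinearMap.proj i : ((Fin k → Fin n) → 𝕜) →ₗ[𝕜] 𝕜)

/-- The jellyfish functional `J_{p,r}`: `J_{p,r} (δ_i) = DET (i ∘ r)` if `i` is constant
on every fiber of `p`, and `0` otherwise. -/
def Jf {k n : ℕ} (p : Fin k → Fin n) (r : Fin n → Fin k) :
    ((Fin k → Fin n) → 𝕜) →ₗ[𝕜] 𝕜 :=
  ∑ i : Fin k → Fin n,
    (if ∀ a b : Fin k, p a = p b → i a = i b then DET (i ∘ r) else (0 : 𝕜)) •
      (LinearMap.proj i : ((Fin k → Fin n) → 𝕜) →ₗ[𝕜] 𝕜)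

/-- The `n × n` matrix `M(i)` whose column `c`, for `c : Fin (n-1)` embedded as the first
`n-1` columns, is the standard basis vector `e_{i (r c)}`, and whose last column is the
all-ones vector. -/
def Mmat {k n : ℕ} (r : Fin (n - 1) → Fin k) (i : Fin k → Fin n) :
    Matrix (Fin n) (Fin n) 𝕜 :=
  Matrix.of fun a b =>
    if h : (b : ℕ) < n - 1 then (if i (r ⟨(b : ℕ), h⟩) = a then 1 else 0) else 1

/-- The jellyfish functional `J'_{p,r}` (one dangling leg): `J'_{p,r} (δ_i) = det M(i)`
if `i` is constant on every fiber of `p`, and `0` otherwise. -/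
def Jf' {k n : ℕ} (p : Fin k → Fin (n - 1)) (r : Fin (n - 1) → Fin k) :
    ((Fin k → Fin n) → 𝕜) →ₗ[𝕜] 𝕜 :=
  ∑ i : Fin k → Fin n,
    (if ∀ a b : Fin k, p a = p b → i a = i b then (Mmat r i).det else (0 : 𝕜)) •
      (LinearMap.proj i : ((Fin k → Fin n) → 𝕜) →ₗ[𝕜] 𝕜)

/-- The linear map `T_P : W_k → W_ℓ` with `(T_P δ_i) (i') = 1` if `Sum.elim i i'` is
constant on every block of `P`, and `0` otherwise. -/
def TP {k l n : ℕ} (P : Finpartition (Finset.univ : Finset (Fin k ⊕ Fin l))) :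
    ((Fin k → Fin n) → 𝕜) →ₗ[𝕜] ((Fin l → Fin n) → 𝕜) :=
  ∑ i : Fin k → Fin n, ∑ i' : Fin l → Fin n,
    (if constOnBlocks P (Sum.elim i i') then (1 : 𝕜) else 0) •
      ((LinearMap.single 𝕜 (fun _ : Fin l → Fin n => 𝕜) i').comp
        (LinearMap.proj i : ((Fin k → Fin n) → 𝕜) →ₗ[𝕜] 𝕜))

/-- The subspace of linear functionals on `(ι → Fin n) → 𝕜` invariant under all
permutations in `S`. -/
def invariantDual (𝕜 : Type*) [Field 𝕜] (ι : Type*) {n : ℕ}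
    (S : Set (Equiv.Perm (Fin n))) :
    Submodule 𝕜 (((ι → Fin n) → 𝕜) →ₗ[𝕜] 𝕜) where
  carrier := {φ | ∀ σ ∈ S, ∀ g : (ι → Fin n) → 𝕜, φ (permAct σ g) = φ g}
  add_mem' := by
    intro φ ψ hφ hψ σ hσ g
    simp only [LinearMap.add_apply, hφ σ hσ g, hψ σ hσ g]
  zero_mem' := by intro σ hσ g; simp
  smul_mem' := by
    intro c φ hφ σ hσ g
    simp only [LinearMap.smul_apply, hφ σ hσ g]

/-- The subspace of linear maps `W_k → W_ℓ` commuting with the actions of all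
permutations in `S`. -/
def equivariantMaps (𝕜 : Type*) [Field 𝕜] (k l : ℕ) {n : ℕ}
    (S : Set (Equiv.Perm (Fin n))) :
    Submodule 𝕜 (((Fin k → Fin n) → 𝕜) →ₗ[𝕜] ((Fin l → Fin n) → 𝕜)) where
  carrier := {T | ∀ σ ∈ S, ∀ g : (Fin k → Fin n) → 𝕜, T (permAct σ g) = permAct σ (T g)}
  add_mem' := by
    intro T T' hT hT' σ hσ g
    funext j
    simp [LinearMap.add_apply, hT σ hσ g, hT' σ hσ g, permAct]
  zero_mem' := by intro σ hσ g; funext j; simp [permAct]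
  smul_mem' := by
    intro c T hT σ hσ g
    funext j
    simp [LinearMap.smul_apply, hT σ hσ g, permAct]

end Jellyfish

open Jellyfish

namespace Jellyfish

/-- The linear functional whose value on `delta i` is `1` if `i ∈ S` and `0` otherwise. -/
def indicatorFunctional (𝕜 : Type*) [Field 𝕜] {k n : ℕ} (S : Set (Fin k → Fin n)) :
    ((Fin k → Fin n) → 𝕜) →ₗ[𝕜] 𝕜 :=
  ∑ i : Fin k → Fin n,
    (if i ∈ S then (1 : 𝕜) else 0) •
      (LinearMap.proj i : ((Fin k → Fin n) → 𝕜) →ₗ[𝕜] 𝕜)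

/-- The orbit of a tuple under the alternating group. -/
def altOrbit {k n : ℕ} (i : Fin k → Fin n) : Set (Fin k → Fin n) :=
  {i' | ∃ τ ∈ alternatingGroup (Fin n), ⇑τ ∘ i = i'}

section Functionals

variable {𝕜 : Type*} [Field 𝕜] {k n : ℕ}

lemma indicatorFunctional_apply (S : Set (Fin k → Fin n)) (g : (Fin k → Fin n) → 𝕜) :
    indicatorFunctional 𝕜 S g = ∑ i, if i ∈ S then g i else 0 := by
  simp only [indicatorFunctional, LinearMap.sum_apply, LinearMap.smul_apply,
    LinearMap.proj_apply, smul_eq_mul, ite_mul, one_mul, zero_mul]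

lemma indicatorFunctional_delta (S : Set (Fin k → Fin n)) (i : Fin k → Fin n) :
    indicatorFunctional 𝕜 S (delta i) = if i ∈ S then 1 else 0 := by
  rw [indicatorFunctional_apply, Finset.sum_eq_single i]
  · simp [delta]
  · intro j _ hj
    simp [delta, hj]
  · simp

lemma permAct_delta (σ : Equiv.Perm (Fin n)) (i : Fin k → Fin n) :
    permAct σ (delta i : (Fin k → Fin n) → 𝕜) = delta (⇑σ ∘ i) := by
  funext j
  have : ⇑σ.symm ∘ j = i ↔ j = ⇑σ ∘ i := by
    constructor
    · rintro rfl
      funext a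
      simp
    · rintro rfl
      funext a
      simp
  simp [permAct, delta, this]

lemma functional_ext_delta {φ ψ : ((Fin k → Fin n) → 𝕜) →ₗ[𝕜] 𝕜}
    (h : ∀ i, φ (delta i) = ψ (delta i)) : φ = ψ := by
  refine LinearMap.pi_ext' fun i => LinearMap.ext_ring ?_
  have hi : (Pi.single i 1 : (Fin k → Fin n) → 𝕜) = delta i := by
    funext j
    simp [delta, Pi.single_apply]
  simpa [hi] using h i

lemma mem_altOrbit_self (i : Fin k → Fin n) : i ∈ altOrbit i :=
  ⟨1, one_mem _, rfl⟩

lemma comp_mem_altOrbit_iff {σ : Equiv.Perm (Fin n)} (hσ : σ ∈ alternatingGroup (Fin n))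
    (t i : Fin k → Fin n) : ⇑σ ∘ i ∈ altOrbit t ↔ i ∈ altOrbit t := by
  constructor
  · rintro ⟨τ, hτ, h⟩
    refine ⟨σ⁻¹ * τ, mul_mem (inv_mem hσ) hτ, ?_⟩
    rw [Equiv.Perm.coe_mul, Function.comp_assoc, h]
    funext a
    simp
  · rintro ⟨τ, hτ, rfl⟩
    exact ⟨σ * τ, mul_mem hσ hτ, rfl⟩

lemma altOrbit_eq_of_mem {t i : Fin k → Fin n} (h : i ∈ altOrbit t) :
    altOrbit i = altOrbit t := by
  obtain ⟨σ, hσ, rfl⟩ := h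
  ext j
  constructor
  · rintro ⟨τ, hτ, rfl⟩
    exact ⟨τ * σ, mul_mem hτ hσ, rfl⟩
  · rintro ⟨τ, hτ, rfl⟩
    refine ⟨τ * σ⁻¹, mul_mem hτ (inv_mem hσ), ?_⟩
    funext a
    simp

/-- The indicator functionals of a family enumerating the alternating-group orbits form a
basis of the space of invariant functionals. -/
lemma basis_of_orbits {ι : Type*} (S : ι → Set (Fin k → Fin n))
    (hcover : ∀ i, ∃ x, i ∈ S x) (hdisj : ∀ x y i, i ∈ S x → i ∈ S y → x = y)
    (horb : ∀ x, ∃ i, S x = altOrbit i) :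
    LinearIndependent 𝕜 (fun x => indicatorFunctional 𝕜 (S x)) ∧
      Submodule.span 𝕜 (Set.range fun x => indicatorFunctional 𝕜 (S x)) =
        invariantDual 𝕜 (Fin k)
          (alternatingGroup (Fin n) : Set (Equiv.Perm (Fin n))) := by
  choose t ht using horb
  have htS : ∀ x, t x ∈ S x := fun x => by rw [ht x]; exact mem_altOrbit_self _
  have hmem : ∀ x y, t x ∈ S y ↔ y = x := fun x y =>
    ⟨fun h => hdisj y x _ h (htS x), fun h => h ▸ htS y⟩
  have : Finite ι := Finite.of_injective t fun x y h => hdisj x y (t x) (htS x) (h ▸ htS y)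
  have := Fintype.ofFinite ι
  refine ⟨?_, le_antisymm ?_ ?_⟩
  · rw [Fintype.linearIndependent_iff]
    intro g hg x
    have := LinearMap.congr_fun hg (delta (t x))
    simpa [LinearMap.sum_apply, indicatorFunctional_delta, hmem] using this
  · rw [Submodule.span_le]
    rintro _ ⟨x, rfl⟩ σ hσ g
    simp only [indicatorFunctional_apply, permAct]
    refine Fintype.sum_equiv (Equiv.arrowCongr (Equiv.refl _) σ.symm) _ _ fun i => ?_
    have : ⇑σ.symm ∘ i ∈ S x ↔ i ∈ S x := by
      rw [ht x]
      exact comp_mem_altOrbit_iff (inv_mem hσ) _ _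
    exact if_congr this.symm rfl rfl
  · intro φ hφ
    have key : φ = ∑ x, φ (delta (t x)) • indicatorFunctional 𝕜 (S x) := by
      refine functional_ext_delta fun i => ?_
      obtain ⟨x, hx⟩ := hcover i
      have hiff : ∀ y, i ∈ S y ↔ y = x := fun y =>
        ⟨fun h => hdisj y x i h hx, fun h => h ▸ hx⟩
      have hval : φ (delta i) = φ (delta (t x)) := by
        rw [ht x] at hx
        obtain ⟨τ, hτ, rfl⟩ := hx
        rw [← permAct_delta]
        exact hφ τ hτ _
      simp [LinearMap.sum_apply, indicatorFunctional_delta, hiff, hval]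
    rw [key]
    exact Submodule.sum_mem _ fun x _ =>
      Submodule.smul_mem _ _ (Submodule.subset_span ⟨x, rfl⟩)

end Functionals

section Kernels

variable {k n : ℕ}

lemma sameBlock_iff_mem_part (P : Finpartition (Finset.univ : Finset (Fin k))) (a b : Fin k) :
    sameBlock P a b ↔ b ∈ P.part a := by
  constructor
  · rintro ⟨B, hB, ha, hb⟩
    rwa [P.part_eq_of_mem hB ha]
  · exact fun h => ⟨P.part a, P.part_mem.2 (Finset.mem_univ a),
      P.mem_part (Finset.mem_univ a), h⟩

lemma parts_eq_of_kernelEq {i : Fin k → Fin n}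
    {P : Finpartition (Finset.univ : Finset (Fin k))} (h : kernelEq i P) :
    P.parts = (Finset.univ.image i).image fun v => Finset.univ.filter fun b => i b = v := by
  have hpart : ∀ a, P.part a = Finset.univ.filter fun b => i b = i a := by
    intro a
    ext b
    rw [← sameBlock_iff_mem_part, ← h a b]
    simp [eq_comm]
  ext B
  simp only [Finset.image_image, Finset.mem_image, Finset.mem_univ, true_and,
    Function.comp_apply, ← hpart]
  constructor
  · intro hB
    obtain ⟨a, ha⟩ := P.nonempty_of_mem_parts hB
    exact ⟨a, P.part_eq_of_mem hB ha⟩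
  · rintro ⟨a, rfl⟩
    exact P.part_mem.2 (Finset.mem_univ a)

lemma kernelEq_unique {i : Fin k → Fin n}
    {P Q : Finpartition (Finset.univ : Finset (Fin k))} (hP : kernelEq i P)
    (hQ : kernelEq i Q) : P = Q :=
  Finpartition.ext (by rw [parts_eq_of_kernelEq hP, parts_eq_of_kernelEq hQ])

lemma card_parts_of_kernelEq {i : Fin k → Fin n}
    {P : Finpartition (Finset.univ : Finset (Fin k))} (h : kernelEq i P) :
    P.parts.card = (Finset.univ.image i).card := by
  rw [parts_eq_of_kernelEq h, Finset.card_image_of_injOn]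
  intro v hv w _ hvw
  obtain ⟨a, -, rfl⟩ := Finset.mem_image.1 hv
  have : a ∈ Finset.univ.filter fun b => i b = i a := by simp
  simp only at hvw
  rw [hvw] at this
  simpa using this

lemma exists_kernelEq_partition (i : Fin k → Fin n) :
    ∃ P : Finpartition (Finset.univ : Finset (Fin k)), kernelEq i P := by
  refine ⟨Finpartition.ofSetoid (Setoid.ker i), fun a b => ?_⟩
  rw [sameBlock_iff_mem_part, Finpartition.mem_part_ofSetoid_iff_rel]
  rfl

lemma exists_kernelEq_tuple (P : Finpartition (Finset.univ : Finset (Fin k)))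
    (hP : P.parts.card ≤ n) : ∃ i : Fin k → Fin n, kernelEq i P := by
  obtain ⟨e⟩ : Nonempty (P.parts ↪ Fin n) :=
    Function.Embedding.nonempty_of_card_le (by simpa using hP)
  refine ⟨fun a => e ⟨P.part a, P.part_mem.2 (Finset.mem_univ a)⟩, fun a b => ?_⟩
  rw [sameBlock_iff_mem_part, e.injective.eq_iff, Subtype.mk.injEq]
  constructor
  · intro h
    rw [h]
    exact P.mem_part (Finset.mem_univ b)
  · intro h
    exact (P.part_eq_of_mem (P.part_mem.2 (Finset.mem_univ a)) h).symm

lemma card_image_perm_comp (σ : Equiv.Perm (Fin n)) (i : Fin k → Fin n) :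
    (Finset.univ.image (⇑σ ∘ i)).card = (Finset.univ.image i).card := by
  rw [← Finset.image_image, Finset.card_image_of_injective _ σ.injective]

lemma exists_perm_comp_eq {i j : Fin k → Fin n} (h : ∀ a b, i a = i b ↔ j a = j b) :
    ∃ σ : Equiv.Perm (Fin n), ⇑σ ∘ i = j := by
  let q : Set.range i → Set.range j := fun v => ⟨j v.2.choose, _, rfl⟩
  have hq : ∀ a, q ⟨i a, a, rfl⟩ = ⟨j a, a, rfl⟩ := fun a =>
    Subtype.ext ((h _ _).1 (⟨a, rfl⟩ : ∃ b, i b = i a).choose_spec)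
  have hbij : Function.Bijective q := by
    constructor
    · rintro ⟨_, a, rfl⟩ ⟨_, b, rfl⟩ hab
      rw [hq, hq] at hab
      exact Subtype.ext ((h a b).2 (congrArg Subtype.val hab))
    · rintro ⟨_, a, rfl⟩
      exact ⟨_, hq a⟩
  refine ⟨(Equiv.ofBijective q hbij).extendSubtype, funext fun a => ?_⟩
  rw [Function.comp_apply, Equiv.extendSubtype_apply_of_mem _ _ ⟨a, rfl⟩]
  exact congrArg Subtype.val (hq a)

/-- Two values missed by `i` allow the parity of the permutation to be corrected. -/
lemma mem_altOrbit_of_ker_eq {i j : Fin k → Fin n} (hn : 2 ≤ n)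
    (hcard : (Finset.univ.image i).card ≤ n - 2) (h : ∀ a b, i a = i b ↔ j a = j b) :
    j ∈ altOrbit i := by
  obtain ⟨σ, rfl⟩ := exists_perm_comp_eq h
  rcases Int.units_eq_one_or (Equiv.Perm.sign σ) with hσ | hσ
  · exact ⟨σ, Equiv.Perm.mem_alternatingGroup.2 hσ, rfl⟩
  have hcompl : 1 < (Finset.univ.image i)ᶜ.card := by
    rw [Finset.card_compl, Fintype.card_fin]
    omega
  obtain ⟨u, hu, v, hv, huv⟩ := Finset.one_lt_card.1 hcompl
  simp only [Finset.mem_compl, Finset.mem_image, Finset.mem_univ, true_and, not_exists] at hu hv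
  refine ⟨σ * Equiv.swap u v, ?_, funext fun a => ?_⟩
  · rw [Equiv.Perm.mem_alternatingGroup, map_mul, hσ, Equiv.Perm.sign_swap huv]
    rfl
  · simp [Equiv.swap_apply_of_ne_of_ne (hu a) (hv a)]

lemma setOf_kernelEq_eq_altOrbit {i : Fin k → Fin n}
    {P : Finpartition (Finset.univ : Finset (Fin k))} (hn : 2 ≤ n)
    (hP : P.parts.card ≤ n - 2) (hi : kernelEq i P) : {j | kernelEq j P} = altOrbit i := by
  ext j
  constructor
  · intro hj
    exact mem_altOrbit_of_ker_eq hn (card_parts_of_kernelEq hi ▸ hP)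
      fun a b => (hi a b).trans (hj a b).symm
  · rintro ⟨τ, -, rfl⟩ a b
    simpa using hi a b

end Kernels

end Jellyfish

/-- the functionals `f_P` for partitions with at most `n - 2` blocks,
together with the orbit-sum functionals over alternating-group orbits of tuples whose
range has at least `n - 1` elements, form a basis of the space of linear functionals on
`W_k` invariant under the alternating group. -/
theorem statement14 (𝕜 : Type*) [Field 𝕜] (hchar : ringChar 𝕜 ≠ 2)
    (n k : ℕ) (hn : 2 ≤ n) :
    let fam : ({P : Finpartition (Finset.univ : Finset (Fin k)) //
          P.parts.card ≤ n - 2} ⊕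
        {O : Set (Fin k → Fin n) // ∃ i : Fin k → Fin n,
          n - 1 ≤ (Finset.univ.image i).card ∧
          O = {i' | ∃ τ ∈ alternatingGroup (Fin n), ⇑τ ∘ i = i'}}) →
        (((Fin k → Fin n) → 𝕜) →ₗ[𝕜] 𝕜) :=
      Sum.elim (fun P => fP P.1)
        (fun O => ∑ i : Fin k → Fin n,
          (if i ∈ O.1 then (1 : 𝕜) else 0) •
            (LinearMap.proj i : ((Fin k → Fin n) → 𝕜) →ₗ[𝕜] 𝕜))
    LinearIndependent 𝕜 fam ∧
      Submodule.span 𝕜 (Set.range fam) =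
        invariantDual 𝕜 (Fin k) (alternatingGroup (Fin n) : Set (Equiv.Perm (Fin n))) := by
  intro fam
  let S : ({P : Finpartition (Finset.univ : Finset (Fin k)) // P.parts.card ≤ n - 2} ⊕
      {O : Set (Fin k → Fin n) // ∃ i : Fin k → Fin n,
        n - 1 ≤ (Finset.univ.image i).card ∧
        O = {i' | ∃ τ ∈ alternatingGroup (Fin n), ⇑τ ∘ i = i'}}) → Set (Fin k → Fin n) :=
    Sum.elim (fun P => {i | kernelEq i P.1}) (fun O => O.1)
  have hfam : fam = fun x => indicatorFunctional 𝕜 (S x) := by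
    funext x
    rcases x with P | O <;> rfl
  have hlarge : ∀ (O : {O : Set (Fin k → Fin n) // ∃ i : Fin k → Fin n,
      n - 1 ≤ (Finset.univ.image i).card ∧
      O = {i' | ∃ τ ∈ alternatingGroup (Fin n), ⇑τ ∘ i = i'}}), ∀ j ∈ O.1,
      n - 1 ≤ (Finset.univ.image j).card ∧ O.1 = altOrbit j := by
    rintro ⟨_, i, hi, rfl⟩ j hj
    refine ⟨?_, (altOrbit_eq_of_mem hj).symm⟩
    obtain ⟨τ, -, rfl⟩ := hj
    rwa [card_image_perm_comp]
  rw [hfam]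
  refine basis_of_orbits S ?_ ?_ ?_
  · intro i
    by_cases hi : n - 1 ≤ (Finset.univ.image i).card
    · exact ⟨Sum.inr ⟨altOrbit i, i, hi, rfl⟩, mem_altOrbit_self i⟩
    · obtain ⟨P, hP⟩ := exists_kernelEq_partition i
      exact ⟨Sum.inl ⟨P, by rw [card_parts_of_kernelEq hP]; omega⟩, hP⟩
  · rintro (P | O) (Q | O') i hx hy
    · exact congrArg Sum.inl (Subtype.ext (kernelEq_unique hx hy))
    · have h₁ := card_parts_of_kernelEq (show kernelEq i P.1 from hx)
      have h₂ := (hlarge O' i hy).1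
      have h₃ := P.2
      omega
    · have h₁ := card_parts_of_kernelEq (show kernelEq i Q.1 from hy)
      have h₂ := (hlarge O i hx).1
      have h₃ := Q.2
      omega
    · exact congrArg Sum.inr
        (Subtype.ext ((hlarge O i hx).2.trans (hlarge O' i hy).2.symm))
  · rintro (P | ⟨_, i, -, rfl⟩)
    · obtain ⟨i, hi⟩ := exists_kernelEq_tuple (n := n) P.1 (P.2.trans (Nat.sub_le n 2))
      exact ⟨i, setOf_kernelEq_eq_altOrbit hn P.2 hi⟩
    · exact ⟨i, rfl⟩
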